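/- Let a ∈ F with V_a(F) ≠ ∅ and let H_a be the stabilizer in H = U(V) of a point ξ_a ∈ V_a(F). (i) If a ≠ 0, then H_a is the unitary group of a hermitian space of dimension m−1. (ii) If a = 0, then H_a is isomorphic to the semidirect product of the unitary group of a hermitian space of dimension m−2 and a group H′, where H′ is the semidirect product of two groups each isomorphic to a power 𝔾_a^r of the additive group. -/

import Mathlib

/-- The unitary group of a form `h` on `E^n` : the group of `E`-linear automorphisms of `E^n`
preserving `h`. -/
def unitaryGroupOf (E : Type*) [Field E] {n : ℕ}
    (h : (Fin n → E) → (Fin n → E) → E) :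
    Subgroup ((Fin n → E) ≃ₗ[E] (Fin n → E)) where
  carrier := {g | ∀ x y, h (g x) (g y) = h x y}
  mul_mem' := by
    intro a b ha hb x y
    have hmul : ∀ z, (a * b) z = a (b z) := fun z => rfl
    rw [hmul, hmul, ha, hb]
  one_mem' := by intro x y; rfl
  inv_mem' := by
    intro a ha x y
    have h1 : ∀ z, a (a⁻¹ z) = z := fun z => a.apply_symm_apply z
    have := ha (a⁻¹ x) (a⁻¹ y)
    rw [h1, h1] at this
    exact this.symm

/-- The stabilizer `H_ξ` in the unitary group `U(h)` of a vector `ξ` : the group of `E`-linear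
automorphisms of `E^n` preserving `h` and fixing `ξ`. -/
def unitaryStabilizer (E : Type*) [Field E] {n : ℕ}
    (h : (Fin n → E) → (Fin n → E) → E) (ξ : Fin n → E) :
    Subgroup ((Fin n → E) ≃ₗ[E] (Fin n → E)) where
  carrier := {g | (∀ x y, h (g x) (g y) = h x y) ∧ g ξ = ξ}
  mul_mem' := by
    intro a b ha hb
    have hmul : ∀ z, (a * b) z = a (b z) := fun z => rfl
    constructor
    · intro x y; rw [hmul, hmul, ha.1, hb.1]
    · rw [hmul, hb.2, ha.2]
  one_mem' := ⟨fun x y => rfl, rfl⟩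
  inv_mem' := by
    intro a ha
    have h1 : ∀ z, a (a⁻¹ z) = z := fun z => a.apply_symm_apply z
    constructor
    · intro x y
      have := ha.1 (a⁻¹ x) (a⁻¹ y)
      rw [h1, h1] at this
      exact this.symm
    · exact a.injective (by rw [h1, ha.2])

section helpers

theorem semidirect_of_split {G N Q : Type*} [Group G] [Group N] [Group Q]
    (π : G →* Q) (s : Q →* G) (hs : ∀ q, π (s q) = q) (i : N →* G)
    (hi : Function.Injective i) (hk : ∀ g, π g = 1 → ∃ n, i n = g) (hik : ∀ n, π (i n) = 1) :
    ∃ φ : Q →* MulAut N, Nonempty (G ≃* N ⋊[φ] Q) := by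
  have hex : ∀ (q : Q) (n : N), ∃ n', i n' = s q * i n * (s q)⁻¹ := fun q n =>
    hk _ (by simp [hik])
  choose c hc using hex
  have hc1 : ∀ n, c 1 n = n := fun n => hi (by simp [hc])
  have hcm : ∀ q q' n, c (q * q') n = c q (c q' n) := fun q q' n => hi (by
    simp [hc, mul_assoc])
  let φ : Q →* MulAut N :=
    { toFun := fun q =>
        { toFun := c q
          invFun := c q⁻¹
          left_inv := fun n => by rw [← hcm, inv_mul_cancel, hc1]
          right_inv := fun n => by rw [← hcm, mul_inv_cancel, hc1]
          map_mul' := fun a b => hi (by simp [hc, mul_assoc]) }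
      map_one' := by ext n; exact hc1 n
      map_mul' := fun a b => by ext n; exact hcm a b n }
  have hφ : ∀ q n, i (φ q n) = s q * i n * (s q)⁻¹ := hc
  refine ⟨φ, ⟨(MulEquiv.ofBijective (MonoidHom.mk' (fun x : N ⋊[φ] Q => i x.left * s x.right) ?_)
    ⟨?_, ?_⟩).symm⟩⟩
  · intro a b
    simp [hφ, mul_assoc]
  · intro a b hab
    have hab' : i a.left * s a.right = i b.left * s b.right := hab
    have h1 : a.right = b.right := by
      have := congrArg π hab'
      simpa [hik, hs] using this
    rw [h1] at hab'
    exact SemidirectProduct.ext (hi (mul_right_cancel hab')) h1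
  · intro g
    obtain ⟨n, hn⟩ := hk (g * (s (π g))⁻¹) (by simp [hs])
    refine ⟨⟨n, π g⟩, ?_⟩
    change i n * s (π g) = g
    rw [hn]; simp

/-- A hermitian form (possibly degenerate). -/
structure IsHerm {F E V : Type*} [Field F] [Field E] [Algebra F E] [AddCommGroup V] [Module E V]
    (σ : E ≃ₐ[F] E) (h : V → V → E) : Prop where
  add : ∀ x y z, h (x + y) z = h x z + h y z
  smul : ∀ (c : E) (x y), h (c • x) y = c * h x y
  conj : ∀ x y, h y x = σ (h x y)

namespace IsHerm
variable {F E V : Type*} [Field F] [Field E] [Algebra F E] [AddCommGroup V] [Module E V]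
    {σ : E ≃ₐ[F] E} {h : V → V → E}

theorem invol (H : IsHerm σ h) (x y : V) : σ (σ (h x y)) = h x y := by
  rw [← H.conj, ← H.conj]

/-- The form as a linear map in the first variable. -/
def left (H : IsHerm σ h) (y : V) : V →ₗ[E] E where
  toFun := fun x => h x y
  map_add' := fun a b => H.add a b y
  map_smul' := fun c a => H.smul c a y

theorem left_apply (H : IsHerm σ h) (x y : V) : H.left y x = h x y := rfl
theorem zero (H : IsHerm σ h) (y : V) : h 0 y = 0 := map_zero (H.left y)
theorem neg (H : IsHerm σ h) (x y : V) : h (-x) y = - h x y := map_neg (H.left y) x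
theorem sub (H : IsHerm σ h) (x z y : V) : h (x - z) y = h x y - h z y := map_sub (H.left y) x z
theorem add_r (H : IsHerm σ h) (x y z : V) : h z (x + y) = h z x + h z y := by
  rw [H.conj _ z, H.add, map_add, ← H.conj, ← H.conj]
theorem smul_r (H : IsHerm σ h) (c : E) (x z : V) : h z (c • x) = σ c * h z x := by
  rw [H.conj _ z, H.smul, map_mul, ← H.conj]
theorem zero_r (H : IsHerm σ h) (y : V) : h y 0 = 0 := by
  rw [H.conj 0 y, H.zero, map_zero]
theorem neg_r (H : IsHerm σ h) (x y : V) : h x (-y) = - h x y := by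
  rw [H.conj _ x, H.neg, map_neg, ← H.conj]
theorem sub_r (H : IsHerm σ h) (x z y : V) : h y (x - z) = h y x - h y z := by
  rw [H.conj _ y, H.sub, map_sub, ← H.conj, ← H.conj]
theorem eq_zero_symm (H : IsHerm σ h) {x y : V} (hxy : h x y = 0) : h y x = 0 := by
  rw [H.conj x y, hxy, map_zero]

theorem finrank_perp [FiniteDimensional E V] (H : IsHerm σ h) (e : V) (he : h e e ≠ 0) :
    Module.finrank E V = Module.finrank E (LinearMap.ker (H.left e)) + 1 := by
  have h1 := LinearMap.finrank_range_add_finrank_ker (H.left e)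
  have h2 : LinearMap.range (H.left e) = ⊤ := by
    rw [LinearMap.range_eq_top]
    intro c
    exact ⟨(c / h e e) • e, by rw [left_apply, H.smul]; field_simp⟩
  rw [h2, finrank_top, Module.finrank_self] at h1
  omega

theorem restrict (H : IsHerm σ h) (W : Submodule E V) :
    IsHerm σ (fun x y : W => h x y) where
  add := fun x y z => H.add x y z
  smul := fun c x y => H.smul c x y
  conj := fun x y => H.conj x y

theorem exists_anisotropic (H : IsHerm σ h) (h2 : (2 : E) ≠ 0) {x y : V} (hxy : h x y ≠ 0) :
    ∃ v, h v v ≠ 0 := by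
  by_contra! hall
  have key : h ((h x y)⁻¹ • x + y) ((h x y)⁻¹ • x + y) = 2 := by
    have h3 : h ((h x y)⁻¹ • x) y = 1 := by rw [H.smul]; field_simp
    rw [H.add, H.add_r, H.add_r, hall, hall, H.conj _ y, h3, map_one]
    norm_num
  rw [hall] at key
  exact h2 key.symm

end IsHerm

theorem exists_real_basis {F E : Type*} [Field F] [Field E] [Algebra F E] (σ : E ≃ₐ[F] E)
    (h2 : (2 : E) ≠ 0) (n : ℕ) : ∀ {V : Type*} [AddCommGroup V] [Module E V]
    [FiniteDimensional E V] {h : V → V → E} (_ : IsHerm σ h) (_ : Module.finrank E V = n),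
    ∃ b : Module.Basis (Fin n) E V, ∀ i j, σ (h (b i) (b j)) = h (b i) (b j) := by
  induction n with
  | zero =>
    intro V _ _ _ h H hn
    exact ⟨Module.finBasisOfFinrankEq E V hn, fun i => i.elim0⟩
  | succ n ih =>
    intro V _ _ _ h H hn
    by_cases h0 : ∃ v, h v v ≠ 0
    · obtain ⟨v, hv⟩ := h0
      have hd := H.finrank_perp v hv
      obtain ⟨b, hb⟩ := ih (H.restrict (LinearMap.ker (H.left v))) (by omega)
      have hperp : ∀ w : LinearMap.ker (H.left v), h w v = 0 := fun w => w.2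
      refine ⟨Module.Basis.mkFinCons v b ?_ ?_, ?_⟩
      · intro c x hx hc
        have h1 : h (c • v + x) v = 0 := by rw [hc, H.zero]
        rw [H.add, H.smul, hperp ⟨x, hx⟩, add_zero] at h1
        exact (mul_eq_zero.mp h1).resolve_right hv
      · intro z
        refine ⟨-(h z v / h v v), ?_⟩
        change h _ v = 0
        rw [H.add, H.smul]
        field_simp
        ring
      · intro i j
        refine Fin.cases ?_ (fun i => ?_) i <;> refine Fin.cases ?_ (fun j => ?_) j
        · simp [← H.conj]
        · simp [H.eq_zero_symm (hperp (b j))]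
        · simp [hperp]
        · simpa using hb i j
    · refine ⟨Module.finBasisOfFinrankEq E V hn, fun i j => ?_⟩
      have hz : ∀ x y, h x y = 0 := by
        intro x y
        by_contra hne
        exact h0 (H.exists_anisotropic h2 hne)
      simp [hz]

/-- `V = ι(W) ⊕ (complement)` orthogonally, with `e` in the complement. -/
structure Setup {E : Type*} [Field E] {m n : ℕ} (h : (Fin m → E) → (Fin m → E) → E)
    (hW : (Fin n → E) → (Fin n → E) → E)
    (ι : (Fin n → E) →ₗ[E] (Fin m → E)) (p : (Fin m → E) →ₗ[E] (Fin n → E))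
    (e : Fin m → E) : Prop where
  pι : ∀ x, p (ι x) = x
  pe : p e = 0
  hι : ∀ x y, h (ι x) (ι y) = hW x y
  orth : ∀ x v, h (ι x) (v - ι (p v)) = 0
  perp : ∀ v, h v e = 0 → ∃ c : E, v = ι (p v) + c • e

namespace Setup
variable {F E : Type*} [Field F] [Field E] [Algebra F E] {m n : ℕ} {σ : E ≃ₐ[F] E}
  {h : (Fin m → E) → (Fin m → E) → E} {hW : (Fin n → E) → (Fin n → E) → E}
  {ι : (Fin n → E) →ₗ[E] (Fin m → E)} {p : (Fin m → E) →ₗ[E] (Fin n → E)} {e : Fin m → E}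

theorem he (S : Setup h hW ι p e) (x : Fin n → E) : h (ι x) e = 0 := by
  have := S.orth x e
  rwa [S.pe, map_zero, sub_zero] at this

theorem hermW (S : Setup h hW ι p e) (H : IsHerm σ h) : IsHerm σ hW where
  add := fun x y z => by rw [← S.hι, ← S.hι, ← S.hι, map_add, H.add]
  smul := fun c x y => by rw [← S.hι, ← S.hι, map_smul, H.smul]
  conj := fun x y => by rw [← S.hι, ← S.hι, H.conj]

theorem nondeg (S : Setup h hW ι p e) (H : IsHerm σ h) (hnd : ∀ x, x ≠ 0 → ∃ y, h x y ≠ 0) :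
    ∀ x, x ≠ 0 → ∃ y, hW x y ≠ 0 := by
  intro x hx
  have hx' : ι x ≠ 0 := by
    intro h0
    apply hx
    rw [← S.pι x, h0, map_zero]
  obtain ⟨y, hy⟩ := hnd _ hx'
  refine ⟨p y, ?_⟩
  have h1 := S.orth x y
  rw [H.sub_r, sub_eq_zero] at h1
  rwa [← S.hι, ← h1]

theorem stab_perp (S : Setup h hW ι p e) {g : (Fin m → E) ≃ₗ[E] (Fin m → E)}
    (hg : g ∈ unitaryStabilizer E h e) (x : Fin n → E) :
    ∃ c : E, g (ι x) = ι (p (g (ι x))) + c • e := by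
  apply S.perp
  have h1 := hg.1 (ι x) e
  rwa [hg.2, S.he] at h1

theorem comp (S : Setup h hW ι p e) {g g' : (Fin m → E) ≃ₗ[E] (Fin m → E)}
    (hg : g ∈ unitaryStabilizer E h e) (hg' : g' ∈ unitaryStabilizer E h e) (x : Fin n → E) :
    p (g (g' (ι x))) = p (g (ι (p (g' (ι x))))) := by
  obtain ⟨c, hc⟩ := S.stab_perp hg' x
  conv_lhs => rw [hc]
  rw [map_add, map_smul, hg.2, map_add, map_smul, S.pe, smul_zero, add_zero]

/-- The induced map on `W`. -/
def piEquiv (S : Setup h hW ι p e) (g : unitaryStabilizer E h e) :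
    (Fin n → E) ≃ₗ[E] (Fin n → E) :=
  LinearEquiv.ofLinearMap (p ∘ₗ g.1.toLinearMap ∘ₗ ι) (p ∘ₗ (g⁻¹).1.toLinearMap ∘ₗ ι)
    (by
      ext1 x
      ext1
      have h1 := S.comp g.2 (g⁻¹).2
      simp only [LinearMap.comp_apply, LinearEquiv.coe_coe, LinearMap.id_apply]
      rw [← h1]
      change p ((g.1 * (g⁻¹).1) (ι _)) = _
      rw [← Subgroup.coe_mul, mul_inv_cancel]
      exact S.pι _)
    (by
      ext1 x
      ext1
      have h1 := S.comp (g⁻¹).2 g.2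
      simp only [LinearMap.comp_apply, LinearEquiv.coe_coe, LinearMap.id_apply]
      rw [← h1]
      change p (((g⁻¹).1 * g.1) (ι _)) = _
      rw [← Subgroup.coe_mul, inv_mul_cancel]
      exact S.pι _)

theorem piEquiv_apply (S : Setup h hW ι p e) (g : unitaryStabilizer E h e) (x : Fin n → E) :
    S.piEquiv g x = p (g.1 (ι x)) := rfl

theorem piEquiv_mem (S : Setup h hW ι p e) (H : IsHerm σ h)
    (g : unitaryStabilizer E h e) : S.piEquiv g ∈ unitaryGroupOf E hW := by
  intro x y
  rw [piEquiv_apply, piEquiv_apply, ← S.hι]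
  obtain ⟨c, hc⟩ := S.stab_perp g.2 x
  have h1 := S.orth (p (g.1 (ι x))) (g.1 (ι y))
  rw [H.sub_r, sub_eq_zero] at h1
  rw [← h1]
  have h2 : h (g.1 (ι x)) (g.1 (ι y)) = h (ι (p (g.1 (ι x)))) (g.1 (ι y)) := by
    have h3 : h e (g.1 (ι y)) = 0 := by
      have := g.2.1 e (ι y)
      rw [g.2.2] at this
      rw [this]
      exact H.eq_zero_symm (S.he y)
    conv_lhs => rw [hc]
    rw [H.add, H.smul, h3, mul_zero, add_zero]
  rw [← h2, g.2.1, S.hι]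

/-- The projection of the stabilizer to `U(W)`. -/
def pi (S : Setup h hW ι p e) (H : IsHerm σ h) :
    unitaryStabilizer E h e →* unitaryGroupOf E hW :=
  MonoidHom.mk' (fun g => ⟨S.piEquiv g, S.piEquiv_mem H g⟩) (by
    intro a b
    apply Subtype.ext
    apply LinearEquiv.ext
    intro x
    exact S.comp a.2 b.2 x)

theorem pi_apply (S : Setup h hW ι p e) (H : IsHerm σ h) (g : unitaryStabilizer E h e)
    (x : Fin n → E) : (S.pi H g).1 x = p (g.1 (ι x)) := rfl

/-- Extension of a map of `W` by the identity, as a linear map. -/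
def ext0 (ι : (Fin n → E) →ₗ[E] (Fin m → E)) (p : (Fin m → E) →ₗ[E] (Fin n → E))
    (u : (Fin n → E) →ₗ[E] (Fin n → E)) : (Fin m → E) →ₗ[E] (Fin m → E) :=
  ι ∘ₗ u ∘ₗ p + (LinearMap.id - ι ∘ₗ p)

theorem ext0_apply (u : (Fin n → E) →ₗ[E] (Fin n → E)) (v : Fin m → E) :
    ext0 ι p u v = ι (u (p v)) + (v - ι (p v)) := rfl

theorem ext0_comp (S : Setup h hW ι p e) (u u' : (Fin n → E) →ₗ[E] (Fin n → E)) (v : Fin m → E) :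
    ext0 ι p u (ext0 ι p u' v) = ext0 ι p (u ∘ₗ u') v := by
  simp only [ext0_apply, map_add, map_sub, S.pι, sub_self, add_zero, LinearMap.comp_apply]
  abel

/-- Extension of an automorphism of `W` by the identity. -/
def extE (S : Setup h hW ι p e) (u : (Fin n → E) ≃ₗ[E] (Fin n → E)) :
    (Fin m → E) ≃ₗ[E] (Fin m → E) :=
  LinearEquiv.ofLinearMap (ext0 ι p u.toLinearMap) (ext0 ι p u.symm.toLinearMap)
    (by
      apply LinearMap.ext
      intro v
      rw [LinearMap.comp_apply, S.ext0_comp, ext0_apply]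
      simp)
    (by
      apply LinearMap.ext
      intro v
      rw [LinearMap.comp_apply, S.ext0_comp, ext0_apply]
      simp)

theorem extE_apply (S : Setup h hW ι p e) (u : (Fin n → E) ≃ₗ[E] (Fin n → E)) (v : Fin m → E) :
    S.extE u v = ι (u (p v)) + (v - ι (p v)) := rfl

theorem extE_mem (S : Setup h hW ι p e) (H : IsHerm σ h) {u : (Fin n → E) ≃ₗ[E] (Fin n → E)}
    (hu : u ∈ unitaryGroupOf E hW) : S.extE u ∈ unitaryStabilizer E h e := by
  constructor
  · intro x y
    have o := S.orth
    have o' : ∀ x v, h (v - ι (p v)) (ι x) = 0 := fun x v => H.eq_zero_symm (o x v)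
    have key : ∀ a b : Fin n → E, h (ι a + (x - ι (p x))) (ι b + (y - ι (p y))) =
        hW a b + h (x - ι (p x)) (y - ι (p y)) := by
      intro a b
      rw [H.add, H.add_r, H.add_r, o, o', S.hι, add_zero, zero_add]
    rw [extE_apply, extE_apply, key, hu, ← key]
    simp
  · rw [extE_apply, S.pe]
    simp

/-- The section `U(W) → Stab(e)`. -/
def sec (S : Setup h hW ι p e) (H : IsHerm σ h) :
    unitaryGroupOf E hW →* unitaryStabilizer E h e :=
  MonoidHom.mk' (fun u => ⟨S.extE u.1, S.extE_mem H u.2⟩) (by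
    intro a b
    apply Subtype.ext
    apply LinearEquiv.ext
    intro x
    exact (S.ext0_comp a.1.toLinearMap b.1.toLinearMap x).symm)

theorem pi_sec (S : Setup h hW ι p e) (H : IsHerm σ h) (u : unitaryGroupOf E hW) :
    S.pi H (S.sec H u) = u := by
  apply Subtype.ext
  apply LinearEquiv.ext
  intro x
  rw [pi_apply]
  change p (ι (u.1 (p (ι x))) + (ι x - ι (p (ι x)))) = _
  simp [S.pι]

/-- Case (i). -/
theorem aniso (S : Setup h hW ι p e) (H : IsHerm σ h) (hee : h e e ≠ 0) :
    Nonempty (unitaryStabilizer E h e ≃* unitaryGroupOf E hW) := by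
  refine ⟨MulEquiv.ofBijective (S.pi H) ⟨?_, fun u => ⟨_, S.pi_sec H u⟩⟩⟩
  rw [injective_iff_map_eq_one]
  intro g hg
  apply Subtype.ext
  apply LinearEquiv.ext
  have hι : ∀ x, g.1 (ι x) = ι x := by
    intro x
    have h1 : p (g.1 (ι x)) = x := by rw [← S.pi_apply H, hg]; rfl
    obtain ⟨c, hc⟩ := S.stab_perp g.2 x
    rw [h1] at hc
    have h2 := g.2.1 (ι x) e
    rw [g.2.2, hc, H.add, H.smul, S.he, zero_add] at h2
    rw [hc, (mul_eq_zero.mp h2).resolve_right hee]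
    simp
  intro v
  obtain ⟨c, hc⟩ := S.perp (v - (h v e / h e e) • e) (by
    rw [H.sub, H.smul]; field_simp; ring)
  have hv : v = ι (p (v - (h v e / h e e) • e)) + (c + h v e / h e e) • e := by
    rw [add_smul, ← add_assoc, ← hc]; simp
  rw [hv]
  change g.1 _ = _
  rw [map_add, hι, map_smul, g.2.2]
  rfl

/-- Construct a setup from an orthogonal projection onto a subspace. -/
theorem exists_of_submodule (σ : E ≃ₐ[F] E) (H : IsHerm σ h) (h2 : (2 : E) ≠ 0)
    (W : Submodule E (Fin m → E)) (hn : Module.finrank E W = n)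
    (P : (Fin m → E) →ₗ[E] (Fin m → E)) (hPW : ∀ v, P v ∈ W) (hP : ∀ w ∈ W, P w = w)
    (ho : ∀ w ∈ W, ∀ v, h w (v - P v) = 0) (hPe : P e = 0)
    (hperp : ∀ v, h v e = 0 → ∃ c : E, v = P v + c • e) :
    ∃ (hW : (Fin n → E) → (Fin n → E) → E)
      (ι : (Fin n → E) →ₗ[E] (Fin m → E)) (p : (Fin m → E) →ₗ[E] (Fin n → E)),
      Setup h hW ι p e ∧ (∀ v, ι (p v) = P v) ∧
      ∀ x y : Fin n → F, σ (hW (fun i => algebraMap F E (x i)) (fun i => algebraMap F E (y i))) =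
        hW (fun i => algebraMap F E (x i)) (fun i => algebraMap F E (y i)) := by
  obtain ⟨b, hb⟩ := exists_real_basis σ h2 n (H.restrict W) hn
  let ι : (Fin n → E) →ₗ[E] (Fin m → E) := W.subtype ∘ₗ b.equivFun.symm.toLinearMap
  let p : (Fin m → E) →ₗ[E] (Fin n → E) := b.equivFun.toLinearMap ∘ₗ P.codRestrict W hPW
  have hιp : ∀ v, ι (p v) = P v := by
    intro v
    simp [ι, p]
  have hιW : ∀ x, ι x ∈ W := fun x => (b.equivFun.symm x).2
  have hinj : Function.Injective ι := W.injective_subtype.comp b.equivFun.symm.injective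
  refine ⟨fun x y => h (ι x) (ι y), ι, p, ⟨?_, ?_, fun _ _ => rfl, ?_, ?_⟩, hιp, ?_⟩
  · intro x
    apply hinj
    rw [hιp, hP _ (hιW x)]
  · apply hinj
    rw [hιp, hPe, map_zero]
  · intro x v
    rw [hιp]
    exact ho _ (hιW x) v
  · intro v hv
    rw [hιp]
    exact hperp v hv
  · have hsum : ∀ x : Fin n → E, ι x = ∑ i, x i • (b i : Fin m → E) := by
      intro x
      simp [ι, Module.Basis.equivFun_symm_apply]
    have hreal : ∀ (x : Fin n → F) (v : Fin m → E), (∀ i, σ (h (b i) v) = h (b i) v) →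
        σ (h (ι (fun i => algebraMap F E (x i))) v) = h (ι (fun i => algebraMap F E (x i))) v := by
      intro x v hv
      have h1 : h (ι (fun i => algebraMap F E (x i))) v = ∑ i, algebraMap F E (x i) * h (b i) v := by
        rw [hsum, ← H.left_apply, map_sum]
        refine Finset.sum_congr rfl fun i _ => ?_
        rw [H.left_apply, H.smul]
      rw [h1, map_sum]
      refine Finset.sum_congr rfl fun i _ => ?_
      rw [map_mul, hv, AlgEquiv.commutes]
    intro x y
    apply hreal
    intro i
    have h3 := hreal y (b i) (fun j => hb j i)
    rw [H.conj _ (b i : Fin m → E), h3, h3]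

end Setup

/-- Setup of case (ii). -/
structure Setup2 {F E : Type*} [Field F] [Field E] [Algebra F E] (σ : E ≃ₐ[F] E) {m n : ℕ}
    (h : (Fin m → E) → (Fin m → E) → E)
    (hW : (Fin n → E) → (Fin n → E) → E)
    (ι : (Fin n → E) →ₗ[E] (Fin m → E)) (p : (Fin m → E) →ₗ[E] (Fin n → E))
    (e f : Fin m → E) (δ : E) (re im : E →ₗ[F] F) : Prop where
  S : Setup h hW ι p e
  H : IsHerm σ h
  two : (2 : E) ≠ 0
  pf : p f = 0
  ee : h e e = 0
  fe : h f e = 1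
  ff : h f f = 0
  dec : ∀ v, v = ι (p v) + h v f • e + h v e • f
  real : ∀ x y : Fin n → F,
    σ (hW (fun i => algebraMap F E (x i)) (fun i => algebraMap F E (y i))) =
        hW (fun i => algebraMap F E (x i)) (fun i => algebraMap F E (y i))
  δ0 : δ ≠ 0
  σδ : σ δ = -δ
  reim : ∀ x, x = algebraMap F E (re x) + δ * algebraMap F E (im x)
  re_alg : ∀ c, re (algebraMap F E c) = c
  im_alg : ∀ c, im (algebraMap F E c) = 0
  im_δ : ∀ c, im (δ * algebraMap F E c) = c

namespace Setup2
variable {F E : Type*} [Field F] [Field E] [Algebra F E] {m n : ℕ} {σ : E ≃ₐ[F] E}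
  {h : (Fin m → E) → (Fin m → E) → E} {hW : (Fin n → E) → (Fin n → E) → E}
  {ι : (Fin n → E) →ₗ[E] (Fin m → E)} {p : (Fin m → E) →ₗ[E] (Fin n → E)} {e f : Fin m → E}
  {δ : E} {re im : E →ₗ[F] F}

theorem ef (T : Setup2 σ h hW ι p e f δ re im) : h e f = 1 := by
  rw [T.H.conj f e, T.fe, map_one]

theorem ιf (T : Setup2 σ h hW ι p e f δ re im) (x : Fin n → E) : h (ι x) f = 0 := by
  have := T.S.orth x f
  rwa [T.pf, map_zero, sub_zero] at this

/-- The unipotent element as linear map. -/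
def nL (T : Setup2 σ h hW ι p e f δ re im) (w : Fin n → E) (τ : E) :
    (Fin m → E) →ₗ[E] (Fin m → E) :=
  LinearMap.id + (T.H.left e).smulRight (ι w)
    + ((τ - hW w w / 2) • T.H.left e - T.H.left (ι w)).smulRight e

theorem nL_apply (T : Setup2 σ h hW ι p e f δ re im) (w : Fin n → E) (τ : E) (v : Fin m → E) :
    T.nL w τ v = v + h v e • ι w + ((τ - hW w w / 2) * h v e - h v (ι w)) • e := rfl

theorem nL_comp (T : Setup2 σ h hW ι p e f δ re im) {w w' : Fin n → E} (τ τ' : E)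
    (hc : hW w w' = hW w' w) (v : Fin m → E) :
    T.nL w τ (T.nL w' τ' v) = T.nL (w + w') (τ + τ') v := by
  have HW := T.S.hermW T.H
  have h2 := T.two
  have e1 : h (T.nL w' τ' v) e = h v e := by
    rw [nL_apply, T.H.add, T.H.add, T.H.smul, T.H.smul, T.ee, T.S.he]; ring
  have e2 : h (T.nL w' τ' v) (ι w) = h v (ι w) + h v e * hW w' w := by
    rw [nL_apply, T.H.add, T.H.add, T.H.smul, T.H.smul, T.H.eq_zero_symm (T.S.he w), T.S.hι]; ring
  rw [nL_apply T w, e1, e2, nL_apply, nL_apply, map_add, T.H.add_r, HW.add, HW.add_r, HW.add_r, hc]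
  have e3 : (τ - hW w w / 2) * h v e - (h v (ι w) + h v e * hW w' w)
      = ((τ + τ' - (hW w w + hW w' w + (hW w' w + hW w' w')) / 2) * h v e
        - (h v (ι w) + h v (ι w'))) - ((τ' - hW w' w' / 2) * h v e - h v (ι w')) := by
    field_simp
    ring
  rw [e3]
  module

theorem nL_zero (T : Setup2 σ h hW ι p e f δ re im) (v : Fin m → E) : T.nL 0 0 v = v := by
  rw [nL_apply, map_zero, (T.S.hermW T.H).zero, T.H.zero_r]; simp

/-- The unipotent element as linear equivalence. -/
def nE (T : Setup2 σ h hW ι p e f δ re im) (w : Fin n → E) (τ : E) :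
    (Fin m → E) ≃ₗ[E] (Fin m → E) :=
  LinearEquiv.ofLinearMap (T.nL w τ) (T.nL (-w) (-τ))
    (by
      apply LinearMap.ext
      intro v
      have HW := T.S.hermW T.H
      rw [LinearMap.comp_apply, T.nL_comp _ _ (by rw [HW.neg, HW.neg_r]), add_neg_cancel,
        add_neg_cancel, nL_zero]
      rfl)
    (by
      apply LinearMap.ext
      intro v
      have HW := T.S.hermW T.H
      rw [LinearMap.comp_apply, T.nL_comp _ _ (by rw [HW.neg, HW.neg_r]), neg_add_cancel,
        neg_add_cancel, nL_zero]
      rfl)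

theorem nE_apply (T : Setup2 σ h hW ι p e f δ re im) (w : Fin n → E) (τ : E) (v : Fin m → E) :
    T.nE w τ v = v + h v e • ι w + ((τ - hW w w / 2) * h v e - h v (ι w)) • e := rfl

theorem nE_ι (T : Setup2 σ h hW ι p e f δ re im) (w : Fin n → E) (τ : E) (x : Fin n → E) :
    T.nE w τ (ι x) = ι x - hW x w • e := by
  rw [nE_apply, T.S.he, T.S.hι]; module

theorem nE_e (T : Setup2 σ h hW ι p e f δ re im) (w : Fin n → E) (τ : E) :
    T.nE w τ e = e := by
  rw [nE_apply, T.ee, T.H.eq_zero_symm (T.S.he w)]; simp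

theorem nE_f (T : Setup2 σ h hW ι p e f δ re im) (w : Fin n → E) (τ : E) :
    T.nE w τ f = f + ι w + (τ - hW w w / 2) • e := by
  rw [nE_apply, T.fe, T.H.eq_zero_symm (T.ιf w)]; simp

theorem nE_mem (T : Setup2 σ h hW ι p e f δ re im) (w : Fin n → E) (τ : E) (hτ : σ τ = -τ) :
    T.nE w τ ∈ unitaryStabilizer E h e := by
  have HW := T.S.hermW T.H
  refine ⟨fun x y => ?_, T.nE_e w τ⟩
  have hww : σ (hW w w) = hW w w := (HW.conj w w).symm
  have h2 := T.two
  have c1 := T.H.conj y e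
  have c2 := T.H.conj y (ι w)
  have HH := T.H
  rw [nE_apply, nE_apply]
  simp only [HH.add, HH.add_r, HH.smul, HH.smul_r, T.ee, T.S.he, HH.eq_zero_symm (T.S.he w),
    map_sub, map_mul, map_div₀, hτ, hww, T.S.hι, ← c1, ← c2, map_ofNat]
  field_simp
  ring

theorem nE_mul (T : Setup2 σ h hW ι p e f δ re im) {w w' : Fin n → E} (τ τ' : E)
    (hc : hW w w' = hW w' w) : T.nE (w + w') (τ + τ') = T.nE w τ * T.nE w' τ' := by
  apply LinearEquiv.ext
  intro v
  exact (T.nL_comp τ τ' hc v).symm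

theorem nE_ker (T : Setup2 σ h hW ι p e f δ re im) (w : Fin n → E) (τ : E) (hτ : σ τ = -τ) :
    (⟨T.nE w τ, T.nE_mem w τ hτ⟩ : unitaryStabilizer E h e) ∈ (T.S.pi T.H).ker := by
  rw [MonoidHom.mem_ker]
  apply Subtype.ext
  apply LinearEquiv.ext
  intro x
  rw [Setup.pi_apply]
  change p (T.nE w τ (ι x)) = x
  rw [nE_ι, map_sub, map_smul, T.S.pι, T.S.pe, smul_zero, sub_zero]

theorem ker_ι (T : Setup2 σ h hW ι p e f δ re im) (g : (T.S.pi T.H).ker) (x : Fin n → E) :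
    p (g.1.1 (ι x)) = x := by
  rw [← T.S.pi_apply T.H, MonoidHom.mem_ker.mp g.2]; rfl

theorem ker_f (T : Setup2 σ h hW ι p e f δ re im) (g : (T.S.pi T.H).ker) :
    g.1.1 f = ι (p (g.1.1 f)) + h (g.1.1 f) f • e + f := by
  have h1 := T.dec (g.1.1 f)
  have h2 := g.1.2.1 f e
  rw [g.1.2.2, T.fe] at h2
  rwa [h2, one_smul] at h1

/-- Each element of the kernel is a unipotent element. -/
theorem ker_eq (T : Setup2 σ h hW ι p e f δ re im) (g : (T.S.pi T.H).ker) :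
    ∃ τ, σ τ = -τ ∧ g.1.1 = T.nE (p (g.1.1 f)) τ := by
  have HW := T.S.hermW T.H
  have HH := T.H
  have h2 := T.two
  set w := p (g.1.1 f) with hw
  set t := h (g.1.1 f) f with ht
  have hf : g.1.1 f = ι w + t • e + f := T.ker_f g
  have hww : σ (hW w w) = hW w w := (HW.conj w w).symm
  have hcond : hW w w + t + σ t = 0 := by
    have h3 := g.1.2.1 f f
    rw [hf, T.ff] at h3
    simp only [HH.add, HH.add_r, HH.smul, HH.smul_r, T.ee, T.S.he, HH.eq_zero_symm (T.S.he w),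
      T.S.hι, T.ιf, HH.eq_zero_symm (T.ιf w), T.ef, T.fe, T.ff] at h3
    linear_combination h3
  refine ⟨t + hW w w / 2, ?_, ?_⟩
  · rw [map_add, map_div₀, hww, map_ofNat]
    field_simp
    linear_combination 2 * hcond
  · have hι : ∀ x, g.1.1 (ι x) = T.nE w (t + hW w w / 2) (ι x) := by
      intro x
      obtain ⟨c, hc⟩ := T.S.stab_perp g.1.2 x
      rw [T.ker_ι] at hc
      have h3 := g.1.2.1 (ι x) f
      rw [hc, hf, T.ιf] at h3
      simp only [HH.add, HH.add_r, HH.smul, HH.smul_r, T.ee, T.S.he, HH.eq_zero_symm (T.S.he w),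
        T.S.hι, T.ιf, T.ef] at h3
      have h4 : c = - hW x w := by linear_combination h3
      rw [hc, nE_ι, h4]
      module
    have hf' : g.1.1 f = T.nE w (t + hW w w / 2) f := by
      rw [hf, nE_f]
      module
    apply LinearEquiv.ext
    intro v
    rw [T.dec v, map_add, map_add, map_add, map_add, map_smul, map_smul, map_smul, map_smul,
      g.1.2.2, nE_e, hι, hf']

theorem p_nE_f (T : Setup2 σ h hW ι p e f δ re im) (w : Fin n → E) (τ : E) :
    p (T.nE w τ f) = w := by
  rw [nE_f, map_add, map_add, map_smul, T.pf, T.S.pe, T.S.pι]; simp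

theorem nE_inj (T : Setup2 σ h hW ι p e f δ re im) {w w' : Fin n → E} {τ τ' : E}
    (heq : T.nE w τ = T.nE w' τ') : w = w' ∧ τ = τ' := by
  have hw : w = w' := by rw [← T.p_nE_f w τ, heq, T.p_nE_f]
  subst hw
  refine ⟨rfl, ?_⟩
  have h1 : h (T.nE w τ f) f = h (T.nE w τ' f) f := by rw [heq]
  simp only [nE_f, T.H.add, T.H.smul, T.ef, T.ff, T.ιf] at h1
  linear_combination h1

/-- The projection from the kernel. -/
def pi2 (T : Setup2 σ h hW ι p e f δ re im) :
    (T.S.pi T.H).ker →* Multiplicative (Fin n → F) :=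
  MonoidHom.mk' (fun g => Multiplicative.ofAdd (fun i => im (p (g.1.1 f) i))) (by
    intro a b
    rw [← ofAdd_add]
    congr 1
    funext i
    have h1 : p ((a * b).1.1 f) = p (a.1.1 f) + p (b.1.1 f) := by
      change p (a.1.1 (b.1.1 f)) = _
      conv_lhs => rw [T.ker_f b]
      rw [map_add a.1.1, map_add a.1.1, map_smul a.1.1, a.1.2.2, map_add p, map_add p, map_smul p,
        T.S.pe, T.ker_ι]
      simp [add_comm]
    rw [h1, Pi.add_apply, map_add]
    rfl)

theorem pi2_nE (T : Setup2 σ h hW ι p e f δ re im) (w : Fin n → E) (τ : E) (hτ : σ τ = -τ) :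
    T.pi2 ⟨⟨T.nE w τ, T.nE_mem w τ hτ⟩, T.nE_ker w τ hτ⟩ =
      Multiplicative.ofAdd (fun i => im (w i)) := by
  change Multiplicative.ofAdd (fun i => im (p (T.nE w τ f) i)) = _
  rw [p_nE_f]

theorem real_symm (T : Setup2 σ h hW ι p e f δ re im) (x y : Fin n → F) :
    hW (fun i => algebraMap F E (x i)) (fun i => algebraMap F E (y i)) =
      hW (fun i => algebraMap F E (y i)) (fun i => algebraMap F E (x i)) := by
  rw [← T.real x y]
  exact ((T.S.hermW T.H).conj _ _).symm

theorem real_symm_δ (T : Setup2 σ h hW ι p e f δ re im) (x y : Fin n → F) :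
    hW (δ • fun i => algebraMap F E (x i)) (δ • fun i => algebraMap F E (y i)) =
      hW (δ • fun i => algebraMap F E (y i)) (δ • fun i => algebraMap F E (x i)) := by
  have HW := T.S.hermW T.H
  rw [HW.smul, HW.smul_r, HW.smul, HW.smul_r, T.real_symm]

/-- The section. -/
def sec2 (T : Setup2 σ h hW ι p e f δ re im) :
    Multiplicative (Fin n → F) →* (T.S.pi T.H).ker :=
  MonoidHom.mk' (fun y => ⟨⟨T.nE (δ • fun i => algebraMap F E (y.toAdd i)) 0,
      T.nE_mem _ _ (by simp)⟩, T.nE_ker _ _ (by simp)⟩) (by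
    intro a b
    apply Subtype.ext
    apply Subtype.ext
    change T.nE _ 0 = T.nE _ 0 * T.nE _ 0
    rw [← T.nE_mul _ _ (T.real_symm_δ _ _), ← smul_add, add_zero]
    congr 2
    funext i
    simp)

theorem σδ_mul (T : Setup2 σ h hW ι p e f δ re im) (c : F) :
    σ (δ * algebraMap F E c) = - (δ * algebraMap F E c) := by
  rw [map_mul, T.σδ, AlgEquiv.commutes]; ring

/-- The inclusion. -/
def inc2 (T : Setup2 σ h hW ι p e f δ re im) :
    Multiplicative (Fin (n + 1) → F) →* (T.S.pi T.H).ker :=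
  MonoidHom.mk' (fun y => ⟨⟨T.nE (fun i => algebraMap F E (y.toAdd i.succ))
      (δ * algebraMap F E (y.toAdd 0)),
      T.nE_mem _ _ (T.σδ_mul _)⟩, T.nE_ker _ _ (T.σδ_mul _)⟩) (by
    intro a b
    apply Subtype.ext
    apply Subtype.ext
    change T.nE _ _ = T.nE _ _ * T.nE _ _
    rw [← T.nE_mul _ _ (T.real_symm _ _)]
    congr 1
    · funext i
      simp
    · simp [mul_add])

theorem ker_semidirect (T : Setup2 σ h hW ι p e f δ re im) :
    ∃ φ' : Multiplicative (Fin n → F) →* MulAut (Multiplicative (Fin (n + 1) → F)),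
      Nonempty ((T.S.pi T.H).ker ≃* (Multiplicative (Fin (n + 1) → F)) ⋊[φ']
        (Multiplicative (Fin n → F))) := by
  have hinjalg := (algebraMap F E).injective
  refine semidirect_of_split T.pi2 T.sec2 ?_ T.inc2 ?_ ?_ ?_
  · intro y
    refine (T.pi2_nE _ _ (by simp)).trans ?_
    simp [T.im_δ]
  · intro a b hab
    have h1 : T.nE _ _ = T.nE _ _ := congrArg (fun g => g.1.1) hab
    obtain ⟨h2, h3⟩ := T.nE_inj h1
    apply Multiplicative.toAdd.injective
    funext i
    refine Fin.cases ?_ (fun i => ?_) i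
    · exact hinjalg (mul_left_cancel₀ T.δ0 h3)
    · exact hinjalg (congrFun h2 i)
  · intro g hg
    obtain ⟨τ, hτ, hgτ⟩ := T.ker_eq g
    have him : ∀ i, im (p (g.1.1 f) i) = 0 := fun i => congrFun (congrArg Multiplicative.toAdd hg) i
    have hre : ∀ i, p (g.1.1 f) i = algebraMap F E (re (p (g.1.1 f) i)) := by
      intro i
      conv_lhs => rw [T.reim (p (g.1.1 f) i), him]
      simp
    have hτ' : τ = δ * algebraMap F E (im τ) := by
      have h1 := T.reim τ
      have h2 : σ τ = algebraMap F E (re τ) - δ * algebraMap F E (im τ) := by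
        conv_lhs => rw [h1]
        rw [map_add, T.σδ_mul, AlgEquiv.commutes]; ring
      have h3 : 2 * (τ - δ * algebraMap F E (im τ)) = 0 := by
        linear_combination h1 - h2 + hτ
      have h4 := (mul_eq_zero.mp h3).resolve_left T.two
      linear_combination h4
    refine ⟨Multiplicative.ofAdd (Fin.cons (im τ) (fun i => re (p (g.1.1 f) i))), ?_⟩
    apply Subtype.ext
    apply Subtype.ext
    refine Eq.trans ?_ hgτ.symm
    change T.nE _ _ = _
    congr 1
    · funext i
      exact (hre i).symm
    · exact hτ'.symm
  · intro y
    refine (T.pi2_nE _ _ (T.σδ_mul _)).trans ?_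
    simp only [T.im_alg]
    rfl

theorem main (T : Setup2 σ h hW ι p e f δ re im) :
    ∃ (φ' : Multiplicative (Fin n → F) →* MulAut (Multiplicative (Fin (n + 1) → F)))
          (φ : (unitaryGroupOf E hW) →*
            MulAut ((Multiplicative (Fin (n + 1) → F)) ⋊[φ'] (Multiplicative (Fin n → F)))),
          Nonempty ((unitaryStabilizer E h e) ≃*
            (((Multiplicative (Fin (n + 1) → F)) ⋊[φ'] (Multiplicative (Fin n → F)))
              ⋊[φ] (unitaryGroupOf E hW))) := by
  obtain ⟨φ', ⟨ψ⟩⟩ := T.ker_semidirect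
  refine ⟨φ', ?_⟩
  refine semidirect_of_split (T.S.pi T.H) (T.S.sec T.H) (T.S.pi_sec T.H)
    ((T.S.pi T.H).ker.subtype.comp ψ.symm.toMonoidHom) ?_ ?_ ?_
  · exact Subtype.val_injective.comp ψ.symm.injective
  · intro g hg
    exact ⟨ψ ⟨g, hg⟩, by simp⟩
  · intro x
    exact (ψ.symm x).2

end Setup2

theorem exists_reim {F E : Type*} [Field F] [Field E] [Algebra F E] (h2 : (2 : E) ≠ 0)
    (hE2 : Module.finrank F E = 2) (σ : E ≃ₐ[F] E) (hσinv : ∀ x, σ (σ x) = x)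
    (hσne : σ ≠ AlgEquiv.refl) : ∃ (δ : E) (re im : E →ₗ[F] F), δ ≠ 0 ∧ σ δ = -δ ∧
    (∀ x, x = algebraMap F E (re x) + δ * algebraMap F E (im x)) ∧
    (∀ c, re (algebraMap F E c) = c) ∧ (∀ c, im (algebraMap F E c) = 0) ∧
    (∀ c, im (δ * algebraMap F E c) = c) := by
  have : ∃ x, σ x ≠ x := by
    by_contra! hall
    exact hσne (AlgEquiv.ext hall)
  obtain ⟨x, hx⟩ := this
  have hδ0 : x - σ x ≠ 0 := fun h0 => hx (sub_eq_zero.mp h0).symm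
  have hδ : σ (x - σ x) = -(x - σ x) := by rw [map_sub, hσinv]; ring
  generalize x - σ x = δ at hδ0 hδ
  have hli : LinearIndependent F ![(1 : E), δ] := by
    rw [LinearIndependent.pair_iff]
    intro s t hst
    rw [Algebra.smul_def, Algebra.smul_def, mul_one] at hst
    have h1 := congrArg σ hst
    rw [map_add, map_mul, hδ, AlgEquiv.commutes, AlgEquiv.commutes, map_zero] at h1
    have h3 : 2 * algebraMap F E s = 0 := by linear_combination hst + h1
    have h4 := (mul_eq_zero.mp h3).resolve_left h2
    rw [h4, zero_add] at hst
    have h5 := (mul_eq_zero.mp hst).resolve_right hδ0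
    exact ⟨(map_eq_zero _).mp h4, (map_eq_zero _).mp h5⟩
  let b := basisOfLinearIndependentOfCardEqFinrank hli (by simp [hE2])
  have hb0 : b 0 = 1 := by simp [b]
  have hb1 : b 1 = δ := by simp [b]
  refine ⟨δ, b.coord 0, b.coord 1, hδ0, hδ, ?_, ?_, ?_, ?_⟩
  · intro y
    have := b.sum_repr y
    rw [Fin.sum_univ_two, hb0, hb1, Algebra.smul_def, Algebra.smul_def, mul_one] at this
    rw [mul_comm δ]
    exact this.symm
  · intro c
    rw [Algebra.algebraMap_eq_smul_one, map_smul, ← hb0]; simp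
  · intro c
    rw [Algebra.algebraMap_eq_smul_one, map_smul, ← hb0]; simp
  · intro c
    rw [mul_comm, ← Algebra.smul_def, map_smul, ← hb1]; simp

end helpers

/-- **Structure of the stabilizer `H_a`** (Xiong, Lemma 2.12; after Weil, Lemma 4.1.1).
Let `F` be a function field in one variable over a finite field with `char F ≠ 2`, `E/F` a
quadratic extension, `V = E^m` (`m ≥ 3`) a non-degenerate hermitian space with unitary group
`H = U(V)`.  Let `a ∈ F` with `V_a(F) ≠ ∅` and let `H_a` be the stabilizer in `H` of a point
`ξ_a ∈ V_a(F)`.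
(i) If `a ≠ 0`, then `H_a` is the unitary group of a hermitian space of dimension `m-1`.
(ii) If `a = 0`, then `H_a` is isomorphic to the semidirect product of the unitary group of a
hermitian space of dimension `m-2` and a group `H'`, where `H'` is the semidirect product of
two groups, each isomorphic to a power `𝔾_a^r` of the additive group (here of `F`-points,
`(F^r, +)`). -/
theorem stabilizer_structure
    -- F : function field in one variable over a finite field, char ≠ 2
    (Fq F : Type*) [Field Fq] [Fintype Fq] [Field F] [Algebra (RatFunc Fq) F]
    (hFF : FunctionField Fq F) (hchar : ringChar F ≠ 2)
    -- E/F : quadratic field extension, with nontrivial F-automorphism σ (conjugation)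
    (E : Type*) [Field E] [Algebra F E] (hE2 : Module.finrank F E = 2)
    (m : ℕ) (hm : 3 ≤ m)
    (σ : E ≃ₐ[F] E) (hσinv : ∀ x, σ (σ x) = x) (hσne : σ ≠ AlgEquiv.refl)
    -- the non-degenerate hermitian form on V = E^m
    (herm : (Fin m → E) → (Fin m → E) → E)
    (herm_add : ∀ x y z, herm (x + y) z = herm x z + herm y z)
    (herm_smul : ∀ (c : E) (x y), herm (c • x) y = c * herm x y)
    (herm_conj : ∀ x y, herm y x = σ (herm x y))
    (herm_nondeg : ∀ x, x ≠ 0 → ∃ y, herm x y ≠ 0)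
    -- a ∈ F and a point ξ_a ∈ V_a(F) (so that V_a(F) ≠ ∅)
    (a : F) (ξa : Fin m → E) (hξa_ne : ξa ≠ 0) (hξa_val : herm ξa ξa = algebraMap F E a) :
    -- (i) : if a ≠ 0 then H_a is of type U_{m-1}
    (a ≠ 0 →
      ∃ hermW : (Fin (m - 1) → E) → (Fin (m - 1) → E) → E,
        (∀ x y z, hermW (x + y) z = hermW x z + hermW y z) ∧
        (∀ (c : E) (x y), hermW (c • x) y = c * hermW x y) ∧
        (∀ x y, hermW y x = σ (hermW x y)) ∧
        (∀ x, x ≠ 0 → ∃ y, hermW x y ≠ 0) ∧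
        Nonempty ((unitaryStabilizer E herm ξa) ≃* (unitaryGroupOf E hermW))) ∧
    -- (ii) : if a = 0 then H_a ≅ H' ⋊ U_{m-2}, where H' = 𝔾_a^{r₁} ⋊ 𝔾_a^{r₂}
    (a = 0 →
      ∃ hermW : (Fin (m - 2) → E) → (Fin (m - 2) → E) → E,
        (∀ x y z, hermW (x + y) z = hermW x z + hermW y z) ∧
        (∀ (c : E) (x y), hermW (c • x) y = c * hermW x y) ∧
        (∀ x y, hermW y x = σ (hermW x y)) ∧
        (∀ x, x ≠ 0 → ∃ y, hermW x y ≠ 0) ∧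
        ∃ (r₁ r₂ : ℕ), 0 < r₁ ∧ 0 < r₂ ∧
        ∃ (φ' : Multiplicative (Fin r₂ → F) →* MulAut (Multiplicative (Fin r₁ → F)))
          (φ : (unitaryGroupOf E hermW) →*
            MulAut ((Multiplicative (Fin r₁ → F)) ⋊[φ'] (Multiplicative (Fin r₂ → F)))),
          Nonempty ((unitaryStabilizer E herm ξa) ≃*
            (((Multiplicative (Fin r₁ → F)) ⋊[φ'] (Multiplicative (Fin r₂ → F)))
              ⋊[φ] (unitaryGroupOf E hermW)))) := by
  have h2F : (2 : F) ≠ 0 := Ring.two_ne_zero hchar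
  have h2 : (2 : E) ≠ 0 := by
    intro h0
    apply h2F
    apply (algebraMap F E).injective
    rw [map_ofNat, h0, map_zero]
  have H : IsHerm σ herm := ⟨herm_add, herm_smul, herm_conj⟩
  have hdim : Module.finrank E (Fin m → E) = m := by simp
  constructor
  · intro ha
    have hee : herm ξa ξa ≠ 0 := by
      rw [hξa_val]
      exact (map_ne_zero _).mpr ha
    have hd := H.finrank_perp ξa hee
    have hPW : ∀ v, (LinearMap.id - ((herm ξa ξa)⁻¹ • H.left ξa).smulRight ξa :
        (Fin m → E) →ₗ[E] (Fin m → E)) v = v - ((herm ξa ξa)⁻¹ * herm v ξa) • ξa := fun v => rfl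
    obtain ⟨hW, ι, p, S, -, -⟩ := Setup.exists_of_submodule (e := ξa) (n := m - 1) σ H h2
      (LinearMap.ker (H.left ξa)) (by omega)
      (LinearMap.id - ((herm ξa ξa)⁻¹ • H.left ξa).smulRight ξa)
      (by
        intro v
        rw [hPW]
        change herm _ ξa = 0
        rw [H.sub, H.smul]
        field_simp
        ring)
      (by
        intro w hw
        have hw' : herm w ξa = 0 := hw
        rw [hPW, hw']
        simp)
      (by
        intro w hw v
        have hw' : herm w ξa = 0 := hw
        rw [hPW, sub_sub_cancel, H.smul_r, hw', mul_zero])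
      (by
        rw [hPW, inv_mul_cancel₀ hee]
        simp)
      (by
        intro v hv
        refine ⟨0, ?_⟩
        rw [hPW, hv]
        simp)
    have HW := S.hermW H
    exact ⟨hW, HW.add, HW.smul, HW.conj, S.nondeg H herm_nondeg, S.aniso H hee⟩
  · intro ha
    have hee : herm ξa ξa = 0 := by rw [hξa_val, ha, map_zero]
    obtain ⟨δ, re, im, hδ0, hσδ, hreim, hre, him, himδ⟩ := exists_reim h2 hE2 σ hσinv hσne
    obtain ⟨f, hfe, hff⟩ : ∃ f, herm f ξa = 1 ∧ herm f f = 0 := by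
      obtain ⟨y, hy⟩ := herm_nondeg ξa hξa_ne
      have hy' : herm y ξa ≠ 0 := fun h0 => hy (H.eq_zero_symm h0)
      obtain ⟨z, hz⟩ : ∃ z, herm z ξa = 1 :=
        ⟨(herm y ξa)⁻¹ • y, by rw [H.smul]; field_simp⟩
      have hz' : herm ξa z = 1 := by rw [H.conj z ξa, hz, map_one]
      have hzz : σ (herm z z) = herm z z := (H.conj z z).symm
      refine ⟨z - (herm z z / 2) • ξa, ?_, ?_⟩
      · rw [H.sub, H.smul, hee, hz]; ring
      · simp only [H.sub, H.sub_r, H.smul, H.smul_r, hee, hz, hz', map_div₀, hzz, map_ofNat]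
        field_simp
        ring
    have hef : herm ξa f = 1 := by rw [H.conj f ξa, hfe, map_one]
    let L : (Fin m → E) →ₗ[E] E × E := (H.left ξa).prod (H.left f)
    have hL : ∀ v, L v = (herm v ξa, herm v f) := fun v => rfl
    have hmemL : ∀ v, v ∈ LinearMap.ker L ↔ herm v ξa = 0 ∧ herm v f = 0 := by
      intro v
      rw [LinearMap.mem_ker, hL, Prod.mk_eq_zero]
    have hd : Module.finrank E (LinearMap.ker L) = m - 2 := by
      have h1 := LinearMap.finrank_range_add_finrank_ker L
      have h3 : LinearMap.range L = ⊤ := by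
        rw [LinearMap.range_eq_top]
        rintro ⟨c, d⟩
        refine ⟨c • f + d • ξa, ?_⟩
        rw [hL]
        simp only [H.add, H.smul, hfe, hff, hee, hef]
        simp
      rw [h3, finrank_top, Module.finrank_prod, Module.finrank_self, hdim] at h1
      omega
    let P : (Fin m → E) →ₗ[E] (Fin m → E) :=
      LinearMap.id - (H.left f).smulRight ξa - (H.left ξa).smulRight f
    have hP : ∀ v, P v = v - herm v f • ξa - herm v ξa • f := fun v => rfl
    obtain ⟨hW, ι, p, S, hιp, hreal⟩ := Setup.exists_of_submodule (e := ξa) (n := m - 2) σ H h2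
      (LinearMap.ker L) hd P
      (by
        intro v
        rw [hP, hmemL]
        simp only [H.sub, H.smul, hfe, hff, hee, hef]
        constructor <;> ring)
      (by
        intro w hw
        rw [hmemL] at hw
        rw [hP, hw.1, hw.2]
        simp)
      (by
        intro w hw v
        rw [hmemL] at hw
        rw [hP]
        simp only [H.sub_r, H.smul_r, hw.1, hw.2]
        ring)
      (by
        rw [hP, hef, hee]
        simp)
      (by
        intro v hv
        refine ⟨herm v f, ?_⟩
        rw [hP, hv]
        simp)
    have hpf : p f = 0 := by
      rw [← S.pι (p f), hιp, hP, hff, hfe]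
      simp
    have T : Setup2 σ herm hW ι p ξa f δ re im :=
      { S := S, H := H, two := h2, pf := hpf, ee := hee, fe := hfe, ff := hff
        dec := by
          intro v
          rw [hιp, hP]
          abel
        real := hreal, δ0 := hδ0, σδ := hσδ, reim := hreim, re_alg := hre, im_alg := him
        im_δ := himδ }
    have HW := S.hermW H
    exact ⟨hW, HW.add, HW.smul, HW.conj, S.nondeg H herm_nondeg, m - 2 + 1, m - 2, by omega,
      by omega, T.main⟩
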